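/- Define g : (0,∞) → ℝ by g(z) = z^c e^{−z} ψ_0(z). Then g is infinitely differentiable on (0,∞) and satisfies the p-th order ordinary differential equation z^p g^{(p)}(z) − c·p·z^{p−1} g^{(p−1)}(z) = (−1)^p z^p g(z) for all z > 0, where g^{(m)} denotes the m-th derivative of g. -/

import Mathlib

open MeasureTheory


/-- The generalized Hänkel function
`ψ_k(z) = (p^{c+1}/Γ(-c)) ∫_1^∞ z^{-c} (uz)^k e^{-(u-1)z} (u^p-1)^{-(c+1)} du`. -/
noncomputable def genHankel (c : ℝ) (p k : ℕ) (z : ℝ) : ℝ :=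
  ((p : ℝ) ^ (c + 1) / Real.Gamma (-c)) *
    ∫ u in Set.Ioi (1 : ℝ),
      z ^ (-c) * (u * z) ^ k * Real.exp (-((u - 1) * z)) * (u ^ p - 1) ^ (-(c + 1))


/-- The moment integrals. -/
noncomputable def hkI (c : ℝ) (p m : ℕ) (z : ℝ) : ℝ :=
  ∫ u in Set.Ioi (1 : ℝ), u ^ m * Real.exp (-(u * z)) * (u ^ p - 1) ^ (-(c + 1))

lemma hk_meas (c : ℝ) (p m : ℕ) (z : ℝ) :
    Measurable (fun u : ℝ => u ^ m * Real.exp (-(u * z)) * (u ^ p - 1) ^ (-(c + 1))) := by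
  fun_prop

lemma hk_integrable (c : ℝ) (hc₁ : -1 < c) (hc₂ : c < 0) (p : ℕ) (hp : 2 ≤ p) (m : ℕ)
    (z : ℝ) (hz : 0 < z) :
    IntegrableOn (fun u : ℝ => u ^ m * Real.exp (-(u * z)) * (u ^ p - 1) ^ (-(c + 1)))
      (Set.Ioi 1) := by
  have h0 : IntegrableOn (fun x : ℝ => x ^ (-(c + 1)) * Real.exp (-(z / 2) * x)) (Set.Ioi 0) := by
    have := integrableOn_rpow_mul_exp_neg_mul_rpow (p := 1) (s := -(c + 1)) (b := z / 2)
      (by linarith) one_pos (by linarith)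
    simpa using this
  have h1 : IntegrableOn (fun x : ℝ => (x - 1) ^ (-(c + 1)) * Real.exp (-(z / 2) * (x - 1)))
      (Set.Ioi 1) := by
    have mp := measurePreserving_sub_right (volume : Measure ℝ) 1
    have := (mp.integrableOn_comp_preimage (MeasurableEquiv.subRight (1:ℝ)).measurableEmbedding
      (f := fun x : ℝ => x ^ (-(c + 1)) * Real.exp (-(z / 2) * x)) (s := Set.Ioi 0)).2 h0
    simpa [Function.comp_def] using this
  have h2 := h1.const_mul ((m.factorial : ℝ) / (z / 2) ^ m * Real.exp (-(z / 2)))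
  refine Integrable.mono' h2 (hk_meas c p m z).aestronglyMeasurable ?_
  refine (ae_restrict_iff' measurableSet_Ioi).2 (Filter.Eventually.of_forall fun u hu => ?_)
  have hu : 1 < u := hu
  have hup : u - 1 ≤ u ^ p - 1 := by
    have := le_self_pow₀ hu.le (show p ≠ 0 by omega)
    linarith
  have hw : (u ^ p - 1) ^ (-(c + 1)) ≤ (u - 1) ^ (-(c + 1)) :=
    Real.rpow_le_rpow_of_nonpos (by linarith) hup (by linarith)
  have hw0 : 0 ≤ (u ^ p - 1) ^ (-(c + 1)) := Real.rpow_nonneg (by linarith) _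
  have he : u ^ m ≤ (m.factorial : ℝ) / (z / 2) ^ m * Real.exp (u * (z / 2)) := by
    have := Real.pow_div_factorial_le_exp (x := u * (z / 2)) (by positivity) m
    rw [mul_pow, div_le_iff₀ (by positivity)] at this
    rw [div_mul_eq_mul_div, le_div_iff₀ (by positivity)]
    linarith
  rw [Real.norm_of_nonneg (by positivity)]
  calc u ^ m * Real.exp (-(u * z)) * (u ^ p - 1) ^ (-(c + 1))
      ≤ ((m.factorial : ℝ) / (z / 2) ^ m * Real.exp (u * (z / 2))) * Real.exp (-(u * z))
        * (u - 1) ^ (-(c + 1)) := by gcongr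
    _ = _ := by
      have : Real.exp (u * (z / 2)) * Real.exp (-(u * z))
        = Real.exp (-(z / 2)) * Real.exp (-(z / 2) * (u - 1)) := by
        rw [← Real.exp_add, ← Real.exp_add]; congr 1; ring
      linear_combination ((m.factorial : ℝ) / (z / 2) ^ m * (u - 1) ^ (-(c + 1))) * this

lemma hk_deriv (c : ℝ) (hc₁ : -1 < c) (hc₂ : c < 0) (p : ℕ) (hp : 2 ≤ p) (m : ℕ)
    (z : ℝ) (hz : 0 < z) : HasDerivAt (hkI c p m) (-hkI c p (m + 1) z) z := by
  have key := hasDerivAt_integral_of_dominated_loc_of_deriv_le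
    (μ := volume.restrict (Set.Ioi (1:ℝ)))
    (F := fun z u : ℝ => u ^ m * Real.exp (-(u * z)) * (u ^ p - 1) ^ (-(c + 1)))
    (F' := fun z u : ℝ => -(u ^ (m + 1) * Real.exp (-(u * z)) * (u ^ p - 1) ^ (-(c + 1))))
    (x₀ := z) (s := Set.Ioi (z / 2))
    (bound := fun u : ℝ => u ^ (m + 1) * Real.exp (-(u * (z / 2))) * (u ^ p - 1) ^ (-(c + 1)))
    (Ioi_mem_nhds (by linarith))
    (Filter.Eventually.of_forall fun x => (hk_meas c p m x).aestronglyMeasurable)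
    (hk_integrable c hc₁ hc₂ p hp m z hz)
    (hk_meas c p (m + 1) z).neg.aestronglyMeasurable
    ?_ (hk_integrable c hc₁ hc₂ p hp (m + 1) (z / 2) (by linarith)) ?_
  · have h := key.2
    rw [integral_neg] at h
    exact h
  · refine (ae_restrict_iff' measurableSet_Ioi).2 (Filter.Eventually.of_forall fun u hu x hx => ?_)
    have hu : 1 < u := hu
    have hx : z / 2 < x := hx
    have hup : 1 ≤ u ^ p := one_le_pow₀ hu.le
    have hw0 : 0 ≤ (u ^ p - 1) ^ (-(c + 1)) := Real.rpow_nonneg (by linarith) _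
    rw [norm_neg, Real.norm_of_nonneg (by positivity)]
    gcongr
  · refine Filter.Eventually.of_forall fun u x _ => ?_
    have h : HasDerivAt (fun x : ℝ => -(u * x)) (-(u * 1)) x := ((hasDerivAt_id x).const_mul u).neg
    refine ((h.exp.const_mul (u ^ m)).mul_const ((u ^ p - 1) ^ (-(c + 1)))).congr_deriv ?_
    ring

lemma hk_contDiff (c : ℝ) (hc₁ : -1 < c) (hc₂ : c < 0) (p : ℕ) (hp : 2 ≤ p) (n : ℕ) :
    ∀ m, ContDiffOn ℝ n (hkI c p m) (Set.Ioi 0) := by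
  induction n with
  | zero =>
    intro m
    refine contDiffOn_zero.2 fun z hz => ?_
    exact (hk_deriv c hc₁ hc₂ p hp m z hz).continuousAt.continuousWithinAt
  | succ n ih =>
    intro m
    push_cast
    rw [contDiffOn_succ_iff_deriv_of_isOpen isOpen_Ioi]
    refine ⟨fun z hz => (hk_deriv c hc₁ hc₂ p hp m z hz).differentiableAt.differentiableWithinAt,
      by simp, ?_⟩
    exact (ih (m + 1)).neg.congr fun z hz => (hk_deriv c hc₁ hc₂ p hp m z hz).deriv

lemma hk_ibp (c : ℝ) (hc₁ : -1 < c) (hc₂ : c < 0) (p : ℕ) (hp : 2 ≤ p)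
    (z : ℝ) (hz : 0 < z) :
    z * (hkI c p p z - hkI c p 0 z) = -c * p * hkI c p (p - 1) z := by
  have ip := hk_integrable c hc₁ hc₂ p hp p z hz
  have i0 := hk_integrable c hc₁ hc₂ p hp 0 z hz
  have i1 := hk_integrable c hc₁ hc₂ p hp (p - 1) z hz
  have id := (i1.const_mul (-c * p)).sub ((ip.sub i0).const_mul z)
  have hd : ∀ u ∈ Set.Ioi (1:ℝ), HasDerivAt
      (fun u : ℝ => (u ^ p - 1) ^ (-c) * Real.exp (-(u * z)))
      ((-c * p) * (u ^ (p - 1) * Real.exp (-(u * z)) * (u ^ p - 1) ^ (-(c + 1))) -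
        z * (u ^ p * Real.exp (-(u * z)) * (u ^ p - 1) ^ (-(c + 1)) -
          u ^ 0 * Real.exp (-(u * z)) * (u ^ p - 1) ^ (-(c + 1)))) u := by
    intro u hu
    have hup : 0 < u ^ p - 1 := by
      have := one_lt_pow₀ (show 1 < u from hu) (show p ≠ 0 by omega)
      linarith
    have h1 := ((hasDerivAt_pow p u).sub_const 1).rpow_const (p := -c) (Or.inl hup.ne')
    have h2 : HasDerivAt (fun u : ℝ => Real.exp (-(u * z))) (Real.exp (-(u * z)) * (-(1 * z))) u :=
      ((hasDerivAt_id u).mul_const z).neg.exp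
    refine (h1.mul h2).congr_deriv ?_
    have e1 : (u ^ p - 1) ^ (-c) = (u ^ p - 1) * (u ^ p - 1) ^ (-(c + 1)) := by
      conv_rhs => rw [← Real.rpow_one_add' hup.le (by linarith)]
      congr 1; ring
    have e2 : -c - 1 = -(c + 1) := by ring
    rw [e1, e2]; ring
  have iF : IntegrableOn (fun u : ℝ => (u ^ p - 1) ^ (-c) * Real.exp (-(u * z))) (Set.Ioi 1) := by
    refine (ip.sub i0).congr_fun (fun u hu => ?_) measurableSet_Ioi
    have hup : 0 < u ^ p - 1 := by
      have := one_lt_pow₀ (show 1 < u from hu) (show p ≠ 0 by omega)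
      linarith
    have e1 : (u ^ p - 1) ^ (-c) = (u ^ p - 1) * (u ^ p - 1) ^ (-(c + 1)) := by
      conv_rhs => rw [← Real.rpow_one_add' hup.le (by linarith)]
      congr 1; ring
    simp only [Pi.sub_apply, e1]; ring
  have ht := tendsto_zero_of_hasDerivAt_of_integrableOn_Ioi hd id iF
  have hcont : ContinuousWithinAt (fun u : ℝ => (u ^ p - 1) ^ (-c) * Real.exp (-(u * z)))
      (Set.Ici 1) 1 := by
    refine Continuous.continuousWithinAt ?_
    refine Continuous.mul ?_ (by fun_prop)
    exact Continuous.rpow_const (by fun_prop) fun _ => Or.inr (by linarith)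
  have h := integral_Ioi_of_hasDerivAt_of_tendsto hcont hd id ht
  have h' := integral_sub (i1.const_mul (-c * p)) ((ip.sub i0).const_mul z)
  have h3 := integral_sub ip i0
  rw [integral_const_mul, integral_const_mul] at h'
  simp only [Pi.sub_apply] at h'
  rw [h', h3] at h
  have hz0 : ((1:ℝ) ^ p - 1) ^ (-c) = 0 := by
    rw [one_pow, sub_self, Real.zero_rpow (by linarith)]
  rw [hz0] at h
  unfold hkI
  linarith

lemma hk_eq (c : ℝ) (p : ℕ) (z : ℝ) (hz : 0 < z) :
    z ^ c * Real.exp (-z) * genHankel c p 0 z =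
      ((p : ℝ) ^ (c + 1) / Real.Gamma (-c)) * hkI c p 0 z := by
  unfold genHankel hkI
  rw [mul_left_comm, ← integral_const_mul]
  congr 2
  ext u
  have h1 : z ^ c * z ^ (-c) = 1 := by rw [← Real.rpow_add hz]; simp
  have h2 : Real.exp (-z) * Real.exp (-((u - 1) * z)) = Real.exp (-(u * z)) := by
    rw [← Real.exp_add]; congr 1; ring
  rw [← h2]
  simp only [pow_zero]
  linear_combination (Real.exp (-z) * Real.exp (-((u - 1) * z)) * (u ^ p - 1) ^ (-(c + 1))) * h1

lemma hk_iter (c : ℝ) (hc₁ : -1 < c) (hc₂ : c < 0) (p : ℕ) (hp : 2 ≤ p) (m : ℕ) :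
    ∀ z : ℝ, 0 < z →
      iteratedDeriv m (fun z : ℝ => z ^ c * Real.exp (-z) * genHankel c p 0 z) z =
      ((p : ℝ) ^ (c + 1) / Real.Gamma (-c)) * (-1) ^ m * hkI c p m z := by
  induction m with
  | zero => intro z hz; simpa using hk_eq c p z hz
  | succ m ih =>
    intro z hz
    rw [iteratedDeriv_succ]
    have : iteratedDeriv m (fun z : ℝ => z ^ c * Real.exp (-z) * genHankel c p 0 z) =ᶠ[nhds z]
        fun z => ((p : ℝ) ^ (c + 1) / Real.Gamma (-c)) * (-1) ^ m * hkI c p m z := by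
      filter_upwards [Ioi_mem_nhds hz] with y hy using ih y hy
    rw [this.deriv_eq, ((hk_deriv c hc₁ hc₂ p hp m z hz).const_mul _).deriv]
    ring

/-- Eq. (1.3′) of the paper.  The function `g(z) = z^c e^{-z} ψ₀(z)`
is smooth on `(0,∞)` and satisfies
`z^p g⁽ᵖ⁾(z) − c p z^{p-1} g⁽ᵖ⁻¹⁾(z) = (−1)^p z^p g(z)`. -/
theorem statement8 (c : ℝ) (hc₁ : -1 < c) (hc₂ : c < 0) (p : ℕ) (hp : 2 ≤ p) :
    ContDiffOn ℝ (⊤ : ℕ∞) (fun z : ℝ => z ^ c * Real.exp (-z) * genHankel c p 0 z)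
      (Set.Ioi (0 : ℝ)) ∧
    ∀ z : ℝ, 0 < z →
      z ^ p * iteratedDeriv p (fun z : ℝ => z ^ c * Real.exp (-z) * genHankel c p 0 z) z -
          c * p * z ^ (p - 1) *
            iteratedDeriv (p - 1) (fun z : ℝ => z ^ c * Real.exp (-z) * genHankel c p 0 z) z
        = (-1) ^ p * z ^ p * (z ^ c * Real.exp (-z) * genHankel c p 0 z) := by
  refine ⟨?_, ?_⟩
  · have h : ContDiffOn ℝ (⊤ : ℕ∞) (hkI c p 0) (Set.Ioi 0) :=
      contDiffOn_infty.2 fun n => hk_contDiff c hc₁ hc₂ p hp n 0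
    exact ((contDiffOn_const (c := (p : ℝ) ^ (c + 1) / Real.Gamma (-c))).mul h).congr fun z hz => hk_eq c p z hz
  · intro z hz
    rw [hk_iter c hc₁ hc₂ p hp p z hz, hk_iter c hc₁ hc₂ p hp (p - 1) z hz, hk_eq c p z hz]
    have h := hk_ibp c hc₁ hc₂ p hp z hz
    obtain ⟨q, rfl⟩ : ∃ q, p = q + 1 := ⟨p - 1, by omega⟩
    simp only [Nat.add_sub_cancel] at *
    generalize (((q + 1 : ℕ) : ℝ) ^ (c + 1) / Real.Gamma (-c)) = C at *
    linear_combination (C * (-1) ^ (q + 1) * z ^ q) * h
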